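/- For a finite simple graph G = (V,E), the following are equivalent: (i) for every generic edge-length assignment λ : E → ℝ_{>0}, the set of congruence classes of plane realizations of G inducing λ is finite and nonempty; (ii) for every generic edge-length assignment λ : E → ℝ_{>0}, the set of congruence classes of spherical realizations of G inducing λ is finite and nonempty. In other words, a graph is minimally rigid in the plane if and only if it is minimally rigid on the sphere. -/

import Mathlib

/-- A finite simple graph: vertices are a finite set of naturals, edges are
two-element subsets of the vertex set. -/
structure GeoGraph where
  V : Finset ℕ
  E : Finset (Finset ℕ)
  edge_sub : ∀ e ∈ E, e ⊆ V
  edge_two : ∀ e ∈ E, e.card = 2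

def IsSubgraph (G' G : GeoGraph) : Prop :=
  G'.V ⊆ G.V ∧ G'.E ⊆ G.E

/-- The Laman conditions: `|E| = 2|V| - 3` and every subgraph with at least two
vertices satisfies `|E'| ≤ 2|V'| - 3`. -/
def Laman (G : GeoGraph) : Prop :=
  2 ≤ G.V.card ∧ G.E.card = 2 * G.V.card - 3 ∧
    ∀ G' : GeoGraph, IsSubgraph G' G → 2 ≤ G'.V.card → G'.E.card ≤ 2 * G'.V.card - 3

/-- A generic edge-length assignment: positive real edge lengths that are
algebraically independent over ℚ. -/
def Generic (G : GeoGraph) (lam : Finset ℕ → ℝ) : Prop :=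
  (∀ e ∈ G.E, 0 < lam e) ∧
    AlgebraicIndependent ℚ (fun e : G.E => lam e.1)

/-- A spherical realization: every vertex goes to the complex sphere. -/
def SphereRealization (G : GeoGraph) (ρ : ℕ → Fin 3 → ℂ) : Prop :=
  ∀ v ∈ G.V, ∑ i, ρ v i ^ 2 = 1

/-- A realization induces the edge lengths `lam`. -/
def SphereInduces (G : GeoGraph) (ρ : ℕ → Fin 3 → ℂ) (lam : Finset ℕ → ℝ) : Prop :=
  ∀ u v : ℕ, ({u, v} : Finset ℕ) ∈ G.E →
    ∑ i, (ρ u i - ρ v i) ^ 2 = (lam {u, v} : ℂ)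

/-- Congruence of spherical realizations via `SO₃(ℂ)`. -/
def SphereCongruent (G : GeoGraph) (ρ ρ' : ℕ → Fin 3 → ℂ) : Prop :=
  ∃ A : Matrix (Fin 3) (Fin 3) ℂ, A * A.transpose = 1 ∧ A.det = 1 ∧
    ∀ v ∈ G.V, ρ' v = A.mulVec (ρ v)

/-- Congruence classes of spherical realizations of `G` inducing `lam`. -/
def SphereClasses (G : GeoGraph) (lam : Finset ℕ → ℝ) : Type :=
  Quot fun ρ ρ' : {ρ : ℕ → Fin 3 → ℂ // SphereRealization G ρ ∧ SphereInduces G ρ lam} =>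
    SphereCongruent G ρ.1 ρ'.1

def PlaneInduces (G : GeoGraph) (ρ : ℕ → Fin 2 → ℂ) (lam : Finset ℕ → ℝ) : Prop :=
  ∀ u v : ℕ, ({u, v} : Finset ℕ) ∈ G.E →
    ∑ i, (ρ u i - ρ v i) ^ 2 = (lam {u, v} : ℂ)

/-- Congruence of plane realizations via `SO₂(ℂ)` and a translation. -/
def PlaneCongruent (G : GeoGraph) (ρ ρ' : ℕ → Fin 2 → ℂ) : Prop :=
  ∃ A : Matrix (Fin 2) (Fin 2) ℂ, ∃ b : Fin 2 → ℂ, A * A.transpose = 1 ∧ A.det = 1 ∧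
    ∀ v ∈ G.V, ρ' v = A.mulVec (ρ v) + b

/-- Congruence classes of plane realizations of `G` inducing `lam`. -/
def PlaneClasses (G : GeoGraph) (lam : Finset ℕ → ℝ) : Type :=
  Quot fun ρ ρ' : {ρ : ℕ → Fin 2 → ℂ // PlaneInduces G ρ lam} =>
    PlaneCongruent G ρ.1 ρ'.1

/-- A calligraph: `{0,1,2} ⊆ V`, `{1,2} ∈ E`, `|E| = 2|V| - 4`, and adding the
edge `{0,1}` or the edge `{0,2}` yields a graph satisfying the Laman conditions. -/
def Calligraph (H : GeoGraph) : Prop :=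
  ({0, 1, 2} : Finset ℕ) ⊆ H.V ∧ ({1, 2} : Finset ℕ) ∈ H.E ∧
    H.E.card = 2 * H.V.card - 4 ∧
    ((∃ H' : GeoGraph, H'.V = H.V ∧ H'.E = insert {0, 1} H.E ∧ Laman H') ∨
     (∃ H' : GeoGraph, H'.V = H.V ∧ H'.E = insert {0, 2} H.E ∧ Laman H'))

/-- A split of `G` into two subgraphs sharing exactly the vertices `0,1,2` and
the edge `{1,2}`. -/
def IsSplit (G G₁ G₂ : GeoGraph) : Prop :=
  G.V = G₁.V ∪ G₂.V ∧ G.E = G₁.E ∪ G₂.E ∧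
    G₁.V ∩ G₂.V = ({0, 1, 2} : Finset ℕ) ∧
    G₁.E ∩ G₂.E = ({{1, 2}} : Finset (Finset ℕ))

/-- A calligraphic split: a split into two calligraphs. -/
def CalligraphicSplit (G G₁ G₂ : GeoGraph) : Prop :=
  IsSplit G G₁ G₂ ∧ Calligraph G₁ ∧ Calligraph G₂

section AlgebraicIndependence

open scoped DualNumber
open Cardinal MvPolynomial

theorem exists_ringEquiv_of_isTranscendenceBasis {B B' : Set ℂ}
    (hB : IsTranscendenceBasis ℚ ((↑) : B → ℂ)) (hB' : IsTranscendenceBasis ℚ ((↑) : B' → ℂ))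
    (g : B ≃ B') : ∃ s : ℂ ≃+* ℂ, ∀ b : B, s b = g b := by
  let := IsAlgClosed.isAlgClosure_of_transcendence_basis _ hB
  let := IsAlgClosed.isAlgClosure_of_transcendence_basis _ hB'
  let e : Algebra.adjoin ℚ (Set.range ((↑) : B → ℂ)) ≃ₐ[ℚ]
      Algebra.adjoin ℚ (Set.range ((↑) : B' → ℂ)) :=
    hB.1.aevalEquiv.symm.trans ((MvPolynomial.renameEquiv ℚ g).trans hB'.1.aevalEquiv)
  refine ⟨IsAlgClosure.equivOfEquiv ℂ ℂ e.toRingEquiv, fun b ↦ ?_⟩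
  have hb : (b : ℂ) = algebraMap (Algebra.adjoin ℚ (Set.range ((↑) : B → ℂ))) ℂ
      (hB.1.aevalEquiv (MvPolynomial.X b)) := by
    simp
  rw [hb, IsAlgClosure.equivOfEquiv_algebraMap]
  simp [e]

theorem exists_ringEquiv_of_algebraicIndependent {ι : Type} [Finite ι] {x y : ι → ℂ}
    (hx : AlgebraicIndependent ℚ x) (hy : AlgebraicIndependent ℚ y) :
    ∃ s : ℂ ≃+* ℂ, ∀ i, s (x i) = y i := by
  obtain ⟨B, hxB, hB⟩ := exists_isTranscendenceBasis_superset hx.to_subtype_range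
  obtain ⟨B', hyB, hB'⟩ := exists_isTranscendenceBasis_superset hy.to_subtype_range
  have hℂ : ℵ₀ < #ℂ := by rw [mk_complex]; exact aleph0_lt_continuum
  have hc := IsAlgClosed.cardinal_eq_cardinal_transcendence_basis_of_aleph0_lt' _ hB (by simp) hℂ
  have hc' := IsAlgClosed.cardinal_eq_cardinal_transcendence_basis_of_aleph0_lt' _ hB' (by simp) hℂ
  let u : ι → B := fun i ↦ ⟨x i, hxB ⟨i, rfl⟩⟩
  let w : ι → B' := fun i ↦ ⟨y i, hyB ⟨i, rfl⟩⟩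
  have hu : u.Injective := fun i j h ↦ hx.injective (congrArg Subtype.val h)
  have hw : w.Injective := fun i j h ↦ hy.injective (congrArg Subtype.val h)
  obtain ⟨g, hg⟩ := extend_function_of_lt
    ((Equiv.ofInjective u hu).symm.toEmbedding.trans ⟨w, hw⟩)
    ((lt_aleph0_of_finite _).trans (hℂ.trans_eq hc)) (Cardinal.eq.1 (hc.symm.trans hc'))
  obtain ⟨s, hs⟩ := exists_ringEquiv_of_isTranscendenceBasis hB hB' g
  refine ⟨s, fun i ↦ ?_⟩
  have := hg ⟨u i, i, rfl⟩
  rw [show x i = (u i : ℂ) from rfl, hs, this]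
  simp [w]

open scoped IntermediateField.algebraAdjoinAdjoin in
theorem formallySmooth_adjoin_of_charZero {K L : Type*} [Field K] [Field L] [CharZero K]
    [Algebra K L] (s : Set L) :
    Algebra.FormallySmooth (Algebra.adjoin K s) L := by
  have : Algebra.FormallySmooth (Algebra.adjoin K s) (IntermediateField.adjoin K s) :=
    .of_isLocalization (nonZeroDivisors _)
  obtain ⟨b, hb⟩ := exists_isTranscendenceBasis (IntermediateField.adjoin K s) L
  have := hb.isAlgebraic_field
  have : Algebra.FormallySmooth (IntermediateField.adjoin K s) L :=
    .of_algebraicIndependent_of_isSeparable hb.1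
  exact .comp _ (IntermediateField.adjoin K s) _

theorem exists_dualNumber_lift {ι : Type} {x : ι → ℂ}
    (hx : AlgebraicIndependent ℚ x) (a : ι → ℂ) :
    ∃ φ : ℂ →+* ℂ[ε], (∀ z, (φ z).fst = z) ∧ ∀ i, (φ (x i)).snd = a i := by
  have := formallySmooth_adjoin_of_charZero (K := ℚ) (Set.range x)
  let p : MvPolynomial ι ℚ →ₐ[ℚ] ℂ[ε] :=
    MvPolynomial.aeval fun i ↦ (TrivSqZeroExt.inl (x i) + TrivSqZeroExt.inr (a i) : ℂ[ε])
  let ψ : Algebra.adjoin ℚ (Set.range x) →ₐ[ℚ] ℂ[ε] := p.comp hx.aevalEquiv.symm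
  have hp : ((TrivSqZeroExt.fstHom ℚ ℂ ℂ).comp p) = MvPolynomial.aeval x := by
    ext i; simp [p]
  have hψ : ∀ z, (ψ z).fst = z := fun z ↦ by
    obtain ⟨q, rfl⟩ := hx.aevalEquiv.surjective z
    simpa [ψ] using DFunLike.congr_fun hp q
  let := ψ.toRingHom.toAlgebra
  let g : ℂ[ε] →ₐ[Algebra.adjoin ℚ (Set.range x)] ℂ :=
    { (TrivSqZeroExt.fstHom ℚ ℂ ℂ).toRingHom with commutes' := fun z ↦ hψ z }
  have hg : Function.Surjective g := fun z ↦ ⟨TrivSqZeroExt.inl z, rfl⟩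
  have hk : IsNilpotent (RingHom.ker g) := by
    refine ⟨2, ?_⟩
    exact TrivSqZeroExt.kerIdeal_sq ℂ ℂ
  let φ := Algebra.FormallySmooth.liftOfSurjective
    (AlgHom.id (Algebra.adjoin ℚ (Set.range x)) ℂ) g hg hk
  refine ⟨φ.toRingHom, fun z ↦ Algebra.FormallySmooth.liftOfSurjective_apply _ g hg hk z,
    fun i ↦ ?_⟩
  have h := φ.commutes (hx.aevalEquiv (MvPolynomial.X i))
  have h' : ψ (hx.aevalEquiv (MvPolynomial.X i)) =
    TrivSqZeroExt.inl (x i) + TrivSqZeroExt.inr (a i) := by simp [ψ, p]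
  have h'' : φ (x i) = TrivSqZeroExt.inl (x i) + TrivSqZeroExt.inr (a i) := by
    rw [← h']
    refine Eq.trans ?_ h
    simp
  simp [h'']

theorem exists_derivation_eq {ι : Type} {x : ι → ℂ} (hx : AlgebraicIndependent ℚ x) (a : ι → ℂ) :
    ∃ D : Derivation ℚ ℂ ℂ, ∀ i, D (x i) = a i := by
  obtain ⟨φ, hφ, hφa⟩ := exists_dualNumber_lift hx a
  let L : ℂ →+ ℂ := (TrivSqZeroExt.sndHom ℂ ℂ).toAddMonoidHom.comp φ.toAddMonoidHom
  refine ⟨Derivation.mk' L.toRatLinearMap fun y z ↦ ?_, hφa⟩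
  have : (φ (y * z)).snd = y * (φ z).snd + z * (φ y).snd := by
    rw [map_mul, DualNumber.snd_mul, hφ, hφ, mul_comm z]
  exact this

theorem nonempty_ringHom_complex_of_countable (K : Type*) [Field K] [CharZero K] [Countable K] :
    Nonempty (K →+* ℂ) := by
  obtain ⟨S, hS⟩ := exists_isTranscendenceBasis ℚ K
  obtain ⟨B, hB⟩ := exists_isTranscendenceBasis ℚ ℂ
  have hℂ : ℵ₀ < #ℂ := by rw [mk_complex]; exact aleph0_lt_continuum
  have hc := IsAlgClosed.cardinal_eq_cardinal_transcendence_basis_of_aleph0_lt' _ hB (by simp) hℂ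
  have : Infinite B := infinite_iff.2 (hℂ.le.trans_eq hc)
  obtain ⟨c, hcS⟩ := Countable.exists_injective_nat S
  let j : S → B := fun s ↦ Infinite.natEmbedding B (c s)
  have hj : j.Injective := (Infinite.natEmbedding B).injective.comp hcS
  have hind : AlgebraicIndependent ℚ fun s ↦ (j s : ℂ) := hB.1.comp j hj
  let ψ : Algebra.adjoin ℚ (Set.range ((↑) : S → K)) →ₐ[ℚ] ℂ :=
    (aeval fun s ↦ (j s : ℂ)).comp hS.1.aevalEquiv.symm.toAlgHom
  have hψ : Function.Injective ψ :=
    (show Function.Injective (aeval fun s ↦ (j s : ℂ)) from hind).comp hS.1.aevalEquiv.symm.injective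
  let := ψ.toRingHom.toAlgebra
  have : FaithfulSMul (Algebra.adjoin ℚ (Set.range ((↑) : S → K))) ℂ :=
    (faithfulSMul_iff_algebraMap_injective _ _).2 hψ
  have := hS.isAlgebraic
  exact ⟨(IsAlgClosed.lift (R := Algebra.adjoin ℚ (Set.range ((↑) : S → K))) (S := K)
    (M := ℂ)).toRingHom⟩

theorem exists_algebraicIndependent_or_relation {σ ι κ : Type} [Countable σ]
    (h : κ → MvPolynomial σ ℚ) (f : ι → MvPolynomial σ ℚ) :
    (∃ x : σ → ℂ, (∀ j, aeval x (h j) = 0) ∧ AlgebraicIndependent ℚ fun i ↦ aeval x (f i)) ∨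
    ∃ P : MvPolynomial ι ℚ, P ≠ 0 ∧ ∀ x : σ → ℂ, (∀ j, aeval x (h j) = 0) →
      aeval (fun i ↦ aeval x (f i)) P = 0 := by
  by_cases hP : ∃ P : MvPolynomial ι ℚ, P ≠ 0 ∧ aeval f P ∈ Ideal.span (Set.range h)
  · obtain ⟨P, hP0, hP⟩ := hP
    refine .inr ⟨P, hP0, fun x hx ↦ ?_⟩
    have hle : Ideal.span (Set.range h) ≤ RingHom.ker (aeval (R := ℚ) x) := by
      rw [Ideal.span_le]
      rintro _ ⟨j, rfl⟩
      exact hx j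
    have := hle hP
    rwa [RingHom.mem_ker, ← AlgHom.comp_apply, comp_aeval] at this
  · push Not at hP
    left
    have hd : Disjoint ((Ideal.span (Set.range h) : Ideal (MvPolynomial σ ℚ)) :
        Set (MvPolynomial σ ℚ))
        ((nonZeroDivisors (MvPolynomial ι ℚ)).map (aeval (R := ℚ) f) :
          Submonoid (MvPolynomial σ ℚ)) := by
      rw [Set.disjoint_right]
      rintro _ ⟨P, hP0, rfl⟩
      exact hP P (nonZeroDivisors.ne_zero hP0)
    obtain ⟨p, hp, hle, hdp⟩ := Ideal.exists_le_prime_disjoint _ _ hd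
    have : Countable (MvPolynomial σ ℚ) := mk_le_aleph0_iff.1
      (cardinalMk_le_max.trans (by simp))
    have : Countable (MvPolynomial σ ℚ ⧸ p) :=
      (Ideal.Quotient.mk_surjective (I := p)).countable
    have : Countable (FractionRing (MvPolynomial σ ℚ ⧸ p)) :=
      (IsLocalization.mk'_surjective (nonZeroDivisors (MvPolynomial σ ℚ ⧸ p))
       ).countable
    have : CharZero (FractionRing (MvPolynomial σ ℚ ⧸ p)) :=
      algebraRat.charZero _
    obtain ⟨φ⟩ := nonempty_ringHom_complex_of_countable (FractionRing (MvPolynomial σ ℚ ⧸ p))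
    let Φ : MvPolynomial σ ℚ →ₐ[ℚ] ℂ := ((φ.comp (algebraMap (MvPolynomial σ ℚ ⧸ p) _)).comp
      (Ideal.Quotient.mk p)).toRatAlgHom
    have hker : ∀ q, Φ q = 0 ↔ q ∈ p := fun q ↦ by
      simp [Φ, Ideal.Quotient.eq_zero_iff_mem]
    have hΦ : ∀ q, aeval (fun s ↦ Φ (X s)) q = Φ q := fun q ↦ by
      exact (DFunLike.congr_fun (aeval_unique Φ) q).symm
    refine ⟨fun s ↦ Φ (X s), fun j ↦ ?_, ?_⟩
    · rw [hΦ, hker]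
      exact hle (Ideal.subset_span ⟨j, rfl⟩)
    · rw [algebraicIndependent_iff]
      intro P hP0
      by_contra hne
      simp_rw [hΦ] at hP0
      have : aeval (fun i ↦ Φ (f i)) P = Φ (aeval f P) := by
        rw [← AlgHom.comp_apply, comp_aeval]
      rw [this, hker] at hP0
      exact Set.disjoint_right.1 hdp ⟨P, mem_nonZeroDivisors_of_ne_zero hne, rfl⟩ hP0

theorem aeval_ringEquiv_comp {σ : Type} (s : ℂ ≃+* ℂ) (x : σ → ℂ) (p : MvPolynomial σ ℚ) :
    aeval (fun i ↦ s (x i)) p = s (aeval x p) :=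
  (comp_aeval_apply x s.toRingHom.toRatAlgHom p).symm

theorem exists_aeval_eq_of_algebraicIndependent {σ ι κ : Type} [Finite ι]
    {h : κ → MvPolynomial σ ℚ} {f : ι → MvPolynomial σ ℚ}
    (H : ∃ x : σ → ℂ, (∀ j, aeval x (h j) = 0) ∧ AlgebraicIndependent ℚ fun i ↦ aeval x (f i))
    {μ : ι → ℂ} (hμ : AlgebraicIndependent ℚ μ) :
    ∃ x : σ → ℂ, (∀ j, aeval x (h j) = 0) ∧ ∀ i, aeval x (f i) = μ i := by
  obtain ⟨x, hx, hf⟩ := H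
  obtain ⟨s, hs⟩ := exists_ringEquiv_of_algebraicIndependent hf hμ
  exact ⟨fun i ↦ s (x i), fun j ↦ by rw [aeval_ringEquiv_comp, hx, map_zero],
    fun i ↦ by rw [aeval_ringEquiv_comp, hs]⟩

theorem aeval_option_elim {ι : Type} (μ : ι → ℂ) (y : ℂ) (P : MvPolynomial (Option ι) ℚ) :
    aeval (fun o : Option ι ↦ o.elim y μ) P =
      ((optionEquivLeft ℚ ι P).map (aeval (R := ℚ) μ).toRingHom).eval y := by
  induction P using MvPolynomial.induction_on with
  | C a => simp [optionEquivLeft_C]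
  | add p q hp hq => simp [hp, hq]
  | mul_X p i hp => cases i <;> simp [hp, optionEquivLeft_X_none, optionEquivLeft_X_some]

theorem finite_aeval_of_not_algebraicIndependent {σ ι κ : Type} [Countable σ]
    {h : κ → MvPolynomial σ ℚ} {f : ι → MvPolynomial σ ℚ} {d : MvPolynomial σ ℚ}
    (H : ¬ ∃ x : σ → ℂ, (∀ j, aeval x (h j) = 0) ∧
      AlgebraicIndependent ℚ fun o : Option ι ↦ o.elim (aeval x d) fun i ↦ aeval x (f i))
    {μ : ι → ℂ} (hμ : AlgebraicIndependent ℚ μ) :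
    {y | ∃ x : σ → ℂ, (∀ j, aeval x (h j) = 0) ∧ (∀ i, aeval x (f i) = μ i) ∧
      aeval x d = y}.Finite := by
  obtain ⟨x, hx, hf⟩ | ⟨P, hP0, hP⟩ :=
    exists_algebraicIndependent_or_relation h fun o : Option ι ↦ o.elim d f
  · refine absurd ⟨x, hx, ?_⟩ H
    convert hf using 2 with o
    cases o <;> rfl
  · set Q := (optionEquivLeft ℚ ι P).map (aeval (R := ℚ) μ).toRingHom with hQ
    have hQ0 : Q ≠ 0 := by
      rw [hQ, Ne, Polynomial.map_eq_zero_iff hμ]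
      simpa using hP0
    refine (Polynomial.finite_setOfPred_isRoot hQ0).subset ?_
    rintro _ ⟨x, hx, hf, rfl⟩
    have := hP x hx
    rw [Set.mem_ofPred_eq, Polynomial.IsRoot, hQ, ← aeval_option_elim, ← this]
    congr 2
    ext o
    cases o <;> simp [hf]

theorem infinite_aeval_of_algebraicIndependent {σ ι κ : Type} [Finite ι]
    {h : κ → MvPolynomial σ ℚ} {f : ι → MvPolynomial σ ℚ} {d : MvPolynomial σ ℚ}
    (H : ∃ x : σ → ℂ, (∀ j, aeval x (h j) = 0) ∧
      AlgebraicIndependent ℚ fun o : Option ι ↦ o.elim (aeval x d) fun i ↦ aeval x (f i))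
    {μ : ι → ℂ} (hμ : AlgebraicIndependent ℚ μ) :
    {y | ∃ x : σ → ℂ, (∀ j, aeval x (h j) = 0) ∧ (∀ i, aeval x (f i) = μ i) ∧
      aeval x d = y}.Infinite := by
  intro hfin
  have hc : Countable (Algebra.adjoin ℚ (Set.range μ)) := by
    have : Countable (MvPolynomial ι ℚ) := mk_le_aleph0_iff.1 (cardinalMk_le_max.trans (by simp))
    exact hμ.aevalEquiv.symm.injective.countable
  have hcount := (Algebraic.countable (Algebra.adjoin ℚ (Set.range μ)) ℂ).union hfin.countable
  refine not_countable_complex (hcount.mono fun y _ ↦ ?_)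
  by_cases hy : IsAlgebraic (Algebra.adjoin ℚ (Set.range μ)) y
  · exact .inl hy
  right
  have hH : ∃ x : σ → ℂ, (∀ j, aeval x (h j) = 0) ∧
      AlgebraicIndependent ℚ fun o : Option ι ↦ aeval x (o.elim d f) := by
    obtain ⟨x, hx, hf⟩ := H
    refine ⟨x, hx, ?_⟩
    convert hf using 2 with o
    cases o <;> rfl
  obtain ⟨x, hx, hf⟩ := exists_aeval_eq_of_algebraicIndependent hH
    ((hμ.option_iff_transcendental y).2 hy)
  exact ⟨x, hx, fun i ↦ hf (some i), hf none⟩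

theorem exists_pos_algebraicIndependent (ι : Type) [Finite ι] :
    ∃ x : ι → ℝ, (∀ i, 0 < x i) ∧ AlgebraicIndependent ℚ x := by
  obtain ⟨B, hB⟩ := exists_isTranscendenceBasis ℚ ℝ
  have : Infinite B := by
    by_contra hfin
    rw [not_infinite_iff_finite] at hfin
    have := hB.isAlgebraic
    have : Countable (MvPolynomial B ℚ) := mk_le_aleph0_iff.1 (cardinalMk_le_max.trans (by simp))
    have : Countable (Algebra.adjoin ℚ (Set.range ((↑) : B → ℝ))) :=
      hB.1.aevalEquiv.symm.injective.countable
    refine Cardinal.not_countable_real ((Algebraic.countable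
      (Algebra.adjoin ℚ (Set.range ((↑) : B → ℝ))) ℝ).mono fun y _ ↦ ?_)
    exact Algebra.IsAlgebraic.isAlgebraic y
  obtain ⟨c, hc⟩ := Countable.exists_injective_nat ι
  have hx : AlgebraicIndependent ℚ fun i ↦ (Infinite.natEmbedding B (c i) : ℝ) :=
    hB.1.comp _ ((Infinite.natEmbedding B).injective.comp hc)
  refine ⟨_, fun i ↦ ?_, hx.polynomial_aeval_of_transcendental (f := fun _ ↦ Polynomial.X ^ 2)
    fun _ ↦ (Polynomial.transcendental_X ℚ).pow two_pos⟩
  have := hx.ne_zero i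
  simp only [map_pow, Polynomial.aeval_X]
  positivity

open Topology in
theorem eventually_exists_sum_sq_eq {X K : Type} [NormedAddCommGroup X] [NormedSpace ℂ X]
    [FiniteDimensional ℂ X] [Fintype K] {d : ℕ} (l : K → Fin d → X →L[ℂ] ℂ) (x₀ : X)
    (hl : ∀ b : K → ℂ, ∃ t, ∀ k, ∑ i, l k i x₀ * l k i t = b k) :
    ∀ᶠ y in 𝓝 (fun k ↦ ∑ i, l k i x₀ ^ 2), ∃ x, (fun k ↦ ∑ i, l k i x ^ 2) = y := by
  have : CompleteSpace X := FiniteDimensional.complete ℂ X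
  let D : X →L[ℂ] K → ℂ := .pi fun k ↦ ∑ i, (2 * l k i x₀) • l k i
  have hD : HasStrictFDerivAt (fun x k ↦ ∑ i, l k i x ^ 2) D x₀ := by
    rw [hasStrictFDerivAt_pi']
    intro k
    refine HasStrictFDerivAt.fun_sum fun i _ ↦ ?_
    convert! (l k i).hasStrictFDerivAt.pow 2 using 1
    simp
  have hsurj : D.range = ⊤ := by
    rw [LinearMap.range_eq_top]
    intro b
    obtain ⟨t, ht⟩ := hl fun k ↦ b k / 2
    refine ⟨t, funext fun k ↦ ?_⟩
    have := ht k
    simp only [D, ContinuousLinearMap.coe_pi', sum_apply,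
      smul_apply, smul_eq_mul, mul_assoc, ← Finset.mul_sum, ContinuousLinearMap.coe_coe]
    rw [this]
    ring
  have := hD.map_nhds_eq_of_surj hsurj
  rw [← this]
  exact Filter.eventually_map.2 (Filter.Eventually.of_forall fun x ↦ ⟨x, rfl⟩)

end AlgebraicIndependence

section Realizations

open MvPolynomial

/-- The squared length of `e` under `ρ`, when `e` consists of two vertices. -/
def sqLength {d : ℕ} (ρ : ℕ → Fin d → ℂ) (e : Finset ℕ) : ℂ :=
  ∑ i, (2 * ∑ v ∈ e, ρ v i ^ 2 - (∑ v ∈ e, ρ v i) ^ 2)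

theorem sqLength_pair {d : ℕ} (ρ : ℕ → Fin d → ℂ) {u v : ℕ} (h : u ≠ v) :
    sqLength ρ {u, v} = ∑ i, (ρ u i - ρ v i) ^ 2 := by
  refine Finset.sum_congr rfl fun i _ ↦ ?_
  rw [Finset.sum_pair h, Finset.sum_pair h]
  ring

/-- The polynomial whose values are `sqLength`. -/
noncomputable def sqLengthPoly (d : ℕ) (e : Finset ℕ) : MvPolynomial (ℕ × Fin d) ℚ :=
  ∑ i, (2 * ∑ v ∈ e, X (v, i) ^ 2 - (∑ v ∈ e, X (v, i)) ^ 2)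

theorem aeval_sqLengthPoly {d : ℕ} (x : ℕ × Fin d → ℂ) (e : Finset ℕ) :
    aeval x (sqLengthPoly d e) = sqLength (fun v i ↦ x (v, i)) e := by
  simp [sqLengthPoly, sqLength]

/-- The vertices in `W` are mapped to the unit sphere. -/
def NormalizedOn {d : ℕ} (W : Finset ℕ) (ρ : ℕ → Fin d → ℂ) : Prop :=
  ∀ v ∈ W, ∑ i, ρ v i ^ 2 = 1

/-- The polynomial cutting out the unit sphere at the vertex `v`. -/
noncomputable def spherePoly (d : ℕ) (v : ℕ) : MvPolynomial (ℕ × Fin d) ℚ :=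
  ∑ i, X (v, i) ^ 2 - 1

theorem forall_aeval_spherePoly_iff {d : ℕ} (W : Finset ℕ) (x : ℕ × Fin d → ℂ) :
    (∀ v : W, aeval x (spherePoly d v) = 0) ↔ NormalizedOn W fun v i ↦ x (v, i) := by
  simp [spherePoly, NormalizedOn, sub_eq_zero]

/-- The pairs in `E` have algebraically independent squared lengths in some realization in
`d`-space that maps `W` to the unit sphere. -/
def GenericallyIndependent (d : ℕ) (W : Finset ℕ) (E : Finset (Finset ℕ)) : Prop :=
  ∃ ρ : ℕ → Fin d → ℂ, NormalizedOn W ρ ∧ AlgebraicIndependent ℚ fun e : E ↦ sqLength ρ e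

/-- The pairs in `E` have linearly independent rows in the rigidity matrix of `ρ`, subject to
the constraint that `W` stays on the unit sphere. -/
def InfinitesimallyIndependent {d : ℕ} (W : Finset ℕ) (E : Finset (Finset ℕ))
    (ρ : ℕ → Fin d → ℂ) : Prop :=
  ∀ a : Finset ℕ → ℂ, ∃ t : ℕ → Fin d → ℂ, (∀ v ∈ W, ∑ i, ρ v i * t v i = 0) ∧
    ∀ u v, u ≠ v → {u, v} ∈ E → ∑ i, (ρ u i - ρ v i) * (t u i - t v i) = a {u, v}

theorem infinitesimallyIndependent_of_algebraicIndependent {d : ℕ} {W : Finset ℕ}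
    {E : Finset (Finset ℕ)} {ρ : ℕ → Fin d → ℂ} (hW : NormalizedOn W ρ)
    (hρ : AlgebraicIndependent ℚ fun e : E ↦ sqLength ρ e) :
    InfinitesimallyIndependent W E ρ := by
  intro a
  obtain ⟨D, hD⟩ := exists_derivation_eq hρ fun e ↦ 2 * a e
  have key (z : Fin d → ℂ) : D (∑ i, z i ^ 2) = 2 * ∑ i, z i * D (z i) := by
    rw [map_sum, Finset.mul_sum]
    refine Finset.sum_congr rfl fun i _ ↦ ?_
    rw [D.leibniz_pow]
    simp
  refine ⟨fun v i ↦ D (ρ v i), fun v hv ↦ ?_, fun u v huv he ↦ ?_⟩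
  · have := key (ρ v)
    rw [hW v hv, D.map_one_eq_zero] at this
    simpa using this.symm
  · have h := hD ⟨_, he⟩
    simp only [sqLength_pair _ huv] at h
    rw [key] at h
    simpa [map_sub] using h

theorem genericallyIndependent_of_infinitesimallyIndependent {d : ℕ} {W : Finset ℕ}
    {E : Finset (Finset ℕ)} (hE : ∀ e ∈ E, e.card = 2) {ρ : ℕ → Fin d → ℂ}
    (hW : NormalizedOn W ρ) (hρ : InfinitesimallyIndependent W E ρ) :
    GenericallyIndependent d W E := by
  obtain ⟨x, hx, hf⟩ | ⟨P, hP0, hP⟩ := exists_algebraicIndependent_or_relation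
    (fun v : W ↦ spherePoly d v) fun e : E ↦ sqLengthPoly d e
  · simp only [aeval_sqLengthPoly] at hf
    exact ⟨_, (forall_aeval_spherePoly_iff W x).1 hx, hf⟩
  exfalso
  simp only [forall_aeval_spherePoly_iff, aeval_sqLengthPoly] at hP
  choose! p q hpq heq using fun e he ↦ Finset.card_eq_two.1 (hE e he)
  let V : Finset ℕ := W ∪ E.biUnion id
  have hWV : W ⊆ V := Finset.subset_union_left
  have hEV : ∀ e ∈ E, e ⊆ V := fun e he ↦
    (Finset.subset_biUnion_of_mem id he).trans Finset.subset_union_right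
  have hpV : ∀ e ∈ E, p e ∈ V := fun e he ↦ hEV e he ((Finset.ext_iff.1 (heq e he) _).2 (by simp))
  have hqV : ∀ e ∈ E, q e ∈ V := fun e he ↦ hEV e he ((Finset.ext_iff.1 (heq e he) _).2 (by simp))
  let c (v : V) (i : Fin d) : (V → Fin d → ℂ) →L[ℂ] ℂ :=
    (ContinuousLinearMap.proj (R := ℂ) (φ := fun _ : Fin d ↦ ℂ) i).comp
      (ContinuousLinearMap.proj (R := ℂ) (φ := fun _ : V ↦ Fin d → ℂ) v)
  let l : E ⊕ W → Fin d → (V → Fin d → ℂ) →L[ℂ] ℂ :=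
    Sum.elim (fun e i ↦ c ⟨p e, hpV e e.2⟩ i - c ⟨q e, hqV e e.2⟩ i)
      fun v ↦ c ⟨v, hWV v.2⟩
  have hl (b : E ⊕ W → ℂ) : ∃ t, ∀ k, ∑ i, l k i (fun v ↦ ρ v) * l k i t = b k := by
    let r (v : ℕ) (i : Fin d) : ℂ := if hv : v ∈ W then b (.inr ⟨v, hv⟩) * ρ v i else 0
    obtain ⟨t, htW, htE⟩ := hρ fun e ↦ if he : e ∈ E then
      b (.inl ⟨e, he⟩) - ∑ i, (ρ (p e) i - ρ (q e) i) * (r (p e) i - r (q e) i) else 0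
    refine ⟨fun v i ↦ t v i + r v i, ?_⟩
    rintro (⟨e, he⟩ | ⟨v, hv⟩)
    · have := htE _ _ (hpq e he) (heq e he ▸ he)
      rw [← heq e he, dif_pos he, eq_sub_iff_add_eq, ← Finset.sum_add_distrib] at this
      rw [← this]
      refine Finset.sum_congr rfl fun i _ ↦ ?_
      simp [l, c]
      ring
    · have h := htW v hv
      have h1 := hW v hv
      simp only [l, c, Sum.elim_inr, ContinuousLinearMap.comp_apply,
        ContinuousLinearMap.proj_apply, mul_add, Finset.sum_add_distrib, h, r, dif_pos hv]
      rw [zero_add]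
      refine (Finset.sum_congr rfl fun i _ ↦ ?_).trans
        ((Finset.mul_sum _ _ _).symm.trans ((congrArg _ h1).trans (mul_one _)))
      ring
  obtain ⟨r, hr, hball⟩ := Metric.eventually_nhds_iff.1 (eventually_exists_sum_sq_eq l _ hl)
  refine hP0 ((map_eq_zero_iff _ (map_injective _ (algebraMap ℚ ℂ).injective)).1 ?_)
  refine funext_set (fun e : E ↦ Metric.ball (∑ i, l (.inl e) i (fun v ↦ ρ v) ^ 2) r)
    (fun e ↦ infinite_of_mem_nhds _ (Metric.ball_mem_nhds _ hr)) fun y hy ↦ ?_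
  have hdist : dist (Sum.elim y fun _ : W ↦ (1 : ℂ))
      (fun k ↦ ∑ i, l k i (fun v ↦ ρ v) ^ 2) < r := by
    rw [dist_pi_lt_iff hr]
    rintro (e | v)
    · exact hy e trivial
    · have := hW v v.2
      simp [l, c, this, hr]
  obtain ⟨x, hx⟩ := hball hdist
  have := hP (fun w ↦ if hv : w.1 ∈ V then x ⟨w.1, hv⟩ w.2 else 0) fun v hv ↦ by
    have h := congrFun hx (.inr ⟨v, hv⟩)
    simpa [l, c, hWV hv] using h
  rw [eval_map, map_zero, ← aeval_def, ← this]
  congr 2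
  ext ⟨e, he⟩
  have h := congrFun hx (.inl ⟨e, he⟩)
  refine Eq.trans ?_ ((congrArg (sqLength _) (heq e he)).trans (sqLength_pair _ (hpq e he))).symm
  simpa [l, c, hpV e he, hqV e he] using h.symm

theorem exists_forall_eval_ne_zero {ι : Type*} (V : Finset ι) {p : ι → Polynomial ℂ}
    (hp : ∀ v ∈ V, p v ≠ 0) : ∃ b, ∀ v ∈ V, (p v).eval b ≠ 0 := by
  by_contra! h
  refine (Finset.prod_ne_zero_iff.2 hp) (Polynomial.funext fun b ↦ ?_)
  obtain ⟨v, hv, hb⟩ := h b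
  rw [Polynomial.eval_prod, Polynomial.eval_zero]
  exact Finset.prod_eq_zero hv hb

theorem GenericallyIndependent.sphere_of_plane {V : Finset ℕ} {E : Finset (Finset ℕ)}
    (hEV : ∀ e ∈ E, e ⊆ V) (hE : ∀ e ∈ E, e.card = 2) (h : GenericallyIndependent 2 ∅ E) :
    GenericallyIndependent 3 V E := by
  obtain ⟨ρ, hW, hρ⟩ := h
  have hinf := infinitesimallyIndependent_of_algebraicIndependent hW hρ
  obtain ⟨b, hb⟩ := exists_forall_eval_ne_zero V
    (p := fun v ↦ (.X + .C (ρ v 0)) ^ 2 + .C (ρ v 1 ^ 2 + 1)) fun v _ h0 ↦ by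
      have h (b : ℂ) := congrArg (Polynomial.eval b) h0
      simp only [Polynomial.eval_add, Polynomial.eval_pow, Polynomial.eval_X, Polynomial.eval_C,
        Polynomial.eval_zero] at h
      exact two_ne_zero (α := ℂ) (by linear_combination h 1 + h (-1) - 2 * h 0)
  choose s hs using fun v ↦ IsAlgClosed.exists_pow_nat_eq
    ((b + ρ v 0) ^ 2 + (ρ v 1 ^ 2 + 1)) two_pos
  have hs0 : ∀ v ∈ V, s v ≠ 0 := fun v hv h0 ↦ hb v hv <| by
    have := hs v
    simpa [h0] using this.symm
  refine genericallyIndependent_of_infinitesimallyIndependent hE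
    (ρ := fun v ↦ ![(b + ρ v 0) / s v, ρ v 1 / s v, 1 / s v]) (fun v hv ↦ ?_) fun a ↦ ?_
  · have := hs0 v hv
    simp only [Fin.sum_univ_three, Matrix.cons_val]
    field_simp
    linear_combination -hs v
  · obtain ⟨t, -, ht⟩ := hinf fun e ↦ a e * ∏ w ∈ e, s w
    refine ⟨fun v ↦ ![t v 0 / s v, t v 1 / s v, -((b + ρ v 0) * t v 0 + ρ v 1 * t v 1) / s v],
      fun v hv ↦ ?_, fun u v huv he ↦ ?_⟩
    · simp only [Fin.sum_univ_three, Matrix.cons_val]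
      ring
    · have h := ht u v huv he
      have hu := hs0 u (hEV _ he (by simp))
      have hv := hs0 v (hEV _ he (by simp))
      rw [Finset.prod_pair huv, Fin.sum_univ_two] at h
      simp only [Fin.sum_univ_three, Matrix.cons_val]
      field_simp
      linear_combination (s u * s v) * h

theorem exists_reflection_third_ne_zero {V : Finset ℕ} {E : Finset (Finset ℕ)}
    (hE : ∀ e ∈ E, e.card = 2) {ρ : ℕ → Fin 3 → ℂ} (hρ : NormalizedOn V ρ) :
    ∃ ρ' : ℕ → Fin 3 → ℂ, NormalizedOn V ρ' ∧ (∀ v ∈ V, ρ' v 2 ≠ 0) ∧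
      ∀ e ∈ E, sqLength ρ' e = sqLength ρ e := by
  let n : Polynomial ℂ := .X ^ 2 + .X ^ 4 + 1
  let p (v : ℕ) : Polynomial ℂ := (.X ^ 2 + .X ^ 4 - 1) * .C (ρ v 2) - .C (2 * ρ v 0) * .X -
    .C (2 * ρ v 1) * .X ^ 2
  have hn : n ≠ 0 := fun h0 ↦ by
    have := congrArg (Polynomial.eval 0) h0
    simp [n] at this
  have hp : ∀ v ∈ V, p v ≠ 0 := fun v hv h0 ↦ by
    have h2 : ρ v 2 = 0 := by
      have := congrArg (Polynomial.eval 0) h0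
      simpa [p] using this
    have h1 := congrArg (Polynomial.eval 1) h0
    have h1' := congrArg (Polynomial.eval (-1)) h0
    simp only [p, h2, map_zero, mul_zero, zero_sub, Polynomial.eval_sub, Polynomial.eval_neg,
      Polynomial.eval_mul, Polynomial.eval_C, Polynomial.eval_X, Polynomial.eval_pow,
      Polynomial.eval_zero] at h1 h1'
    have := hρ v hv
    rw [Fin.sum_univ_three, h2, show ρ v 0 = 0 by linear_combination (h1' - h1) / 4,
      show ρ v 1 = 0 by linear_combination -(h1' + h1) / 4] at this
    simp at this
  obtain ⟨α, hα⟩ := exists_forall_eval_ne_zero V (p := fun v ↦ n * p v)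
    fun v hv ↦ mul_ne_zero hn (hp v hv)
  by_cases hV : V = ∅
  · exact ⟨ρ, hρ, by simp [hV], fun _ _ ↦ rfl⟩
  have hα0 : α ^ 2 + α ^ 4 + 1 ≠ 0 := by
    obtain ⟨v, hv⟩ := Finset.nonempty_iff_ne_empty.2 hV
    have := hα v hv
    rw [Polynomial.eval_mul] at this
    simpa [n] using left_ne_zero_of_mul this
  obtain ⟨N, hN⟩ : ∃ N, N = α ^ 2 + α ^ 4 + 1 := ⟨_, rfl⟩
  rw [← hN] at hα0
  let H (x : Fin 3 → ℂ) : Fin 3 → ℂ := fun i ↦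
    x i - 2 * (α * x 0 + α ^ 2 * x 1 + x 2) / N * ![α, α ^ 2, 1] i
  have hH (x : Fin 3 → ℂ) : ∑ i, H x i ^ 2 = ∑ i, x i ^ 2 := by
    simp only [H, Fin.sum_univ_three, Matrix.cons_val]
    field_simp
    linear_combination -4 * (α * x 0 + α ^ 2 * x 1 + x 2) ^ 2 * hN
  refine ⟨fun v ↦ H (ρ v), fun v hv ↦ (hH _).trans (hρ v hv), fun v hv h0 ↦ hα v hv ?_,
    fun e he ↦ ?_⟩
  · simp only [H, Matrix.cons_val] at h0
    field_simp at h0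
    rw [Polynomial.eval_mul]
    convert! mul_zero _
    simp [p]
    linear_combination h0 - ρ v 2 * hN
  · obtain ⟨u, v, huv, rfl⟩ := Finset.card_eq_two.1 (hE e he)
    rw [sqLength_pair _ huv, sqLength_pair _ huv]
    refine Eq.trans ?_ (hH fun i ↦ ρ u i - ρ v i)
    refine Finset.sum_congr rfl fun i _ ↦ ?_
    simp only [H]
    ring

theorem GenericallyIndependent.plane_of_sphere {V : Finset ℕ} {E : Finset (Finset ℕ)}
    (hEV : ∀ e ∈ E, e ⊆ V) (hE : ∀ e ∈ E, e.card = 2) (h : GenericallyIndependent 3 V E) :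
    GenericallyIndependent 2 ∅ E := by
  obtain ⟨ρ₀, hW₀, hρ₀⟩ := h
  obtain ⟨ρ, hW, hz, hlen⟩ := exists_reflection_third_ne_zero hE hW₀
  have hρ : AlgebraicIndependent ℚ fun e : E ↦ sqLength ρ e := by
    convert hρ₀ using 2 with e
    exact hlen e e.2
  have hinf := infinitesimallyIndependent_of_algebraicIndependent hW hρ
  refine genericallyIndependent_of_infinitesimallyIndependent hE
    (ρ := fun v ↦ ![ρ v 0 / ρ v 2, ρ v 1 / ρ v 2]) (by simp [NormalizedOn]) fun a ↦ ?_
  obtain ⟨t, htV, ht⟩ := hinf fun e ↦ a e * ∏ w ∈ e, ρ w 2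
  refine ⟨fun v ↦ ![t v 0 / ρ v 2, t v 1 / ρ v 2], by simp, fun u v huv he ↦ ?_⟩
  have h := ht u v huv he
  have huV := hEV _ he (Finset.mem_insert_self u {v})
  have hvV := hEV _ he (Finset.mem_insert_of_mem (Finset.mem_singleton_self v))
  have hu := hz u huV
  have hv := hz v hvV
  have htu := htV u huV
  have htv := htV v hvV
  rw [Fin.sum_univ_three] at htu htv
  rw [Finset.prod_pair huv, Fin.sum_univ_three] at h
  simp only [Fin.sum_univ_two, Matrix.cons_val]
  field_simp
  linear_combination (ρ u 2 * ρ v 2) * h + (ρ v 2 ^ 2 - ρ u 2 * ρ v 2) * htu +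
    (ρ u 2 ^ 2 - ρ u 2 * ρ v 2) * htv

/-- `E` is a maximal generically independent set of pairs in `V`. -/
def MaximallyIndependent (d : ℕ) (W V : Finset ℕ) (E : Finset (Finset ℕ)) : Prop :=
  GenericallyIndependent d W E ∧ ∀ u ∈ V, ∀ v ∈ V, u ≠ v → {u, v} ∉ E →
    ¬ GenericallyIndependent d W (insert {u, v} E)

theorem maximallyIndependent_plane_iff_sphere {V : Finset ℕ} {E : Finset (Finset ℕ)}
    (hEV : ∀ e ∈ E, e ⊆ V) (hE : ∀ e ∈ E, e.card = 2) :
    MaximallyIndependent 2 ∅ V E ↔ MaximallyIndependent 3 V V E := by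
  refine and_congr ⟨.sphere_of_plane hEV hE, .plane_of_sphere hEV hE⟩ <|
    forall₂_congr fun u hu ↦ forall₂_congr fun v hv ↦ forall₂_congr fun huv _ ↦ not_congr ?_
  have hEV' : ∀ e ∈ insert {u, v} E, e ⊆ V := by
    simpa [Finset.insert_subset_iff, hu, hv] using hEV
  have hE' : ∀ e ∈ insert {u, v} E, e.card = 2 := by
    simpa [Finset.card_pair huv] using hE
  exact ⟨.sphere_of_plane hEV' hE', .plane_of_sphere hEV' hE'⟩

theorem genericallyIndependent_plane_singleton {u v : ℕ} (huv : u ≠ v) :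
    GenericallyIndependent 2 ∅ {{u, v}} := by
  refine genericallyIndependent_of_infinitesimallyIndependent (by simp [Finset.card_pair huv])
    (ρ := fun w ↦ if w = u then 0 else ![1, 0]) (by simp [NormalizedOn]) fun a ↦
    ⟨fun w ↦ if w = u then 0 else ![a {u, v}, 0], by simp, fun x y hxy h ↦ ?_⟩
  rw [Finset.mem_singleton] at h
  rw [h]
  have hx : x = u ∨ x = v := by simpa using h.subset (Finset.mem_insert_self x {y})
  have hy : y = u ∨ y = v := by simpa using h.subset (Finset.mem_insert_of_mem
    (Finset.mem_singleton_self y))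
  obtain rfl | rfl := hx <;> obtain rfl | rfl := hy <;>
    simp_all [Fin.sum_univ_two, Ne.symm]

theorem MaximallyIndependent.exists_pair_mem_or_subsingleton {V : Finset ℕ}
    {E : Finset (Finset ℕ)} (hEV : ∀ e ∈ E, e ⊆ V) (hE : ∀ e ∈ E, e.card = 2)
    (h : MaximallyIndependent 2 ∅ V E) :
    (∃ u ∈ V, ∃ v ∈ V, u ≠ v ∧ {u, v} ∈ E) ∨ (V : Set ℕ).Subsingleton := by
  obtain rfl | ⟨e, he⟩ := E.eq_empty_or_nonempty
  · refine .inr fun u hu v hv ↦ ?_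
    by_contra huv
    exact h.2 u hu v hv huv (by simp) (genericallyIndependent_plane_singleton huv)
  · obtain ⟨u, v, huv, rfl⟩ := Finset.card_eq_two.1 (hE e he)
    exact .inl ⟨u, hEV _ he (by simp), v, hEV _ he (by simp), huv, he⟩

variable {d : ℕ} {W : Finset ℕ} {E : Finset (Finset ℕ)} {μ : Finset ℕ → ℂ}

theorem genericallyIndependent_insert_iff {e : Finset ℕ} (he : e ∉ E) :
    GenericallyIndependent d W (insert e E) ↔
      ∃ x : ℕ × Fin d → ℂ, (∀ v : W, aeval x (spherePoly d v) = 0) ∧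
        AlgebraicIndependent ℚ fun o : Option E ↦
          o.elim (aeval x (sqLengthPoly d e)) fun i ↦ aeval x (sqLengthPoly d i) := by
  have key (ρ : ℕ → Fin d → ℂ) : AlgebraicIndependent ℚ (fun e' : ↥(insert e E) ↦ sqLength ρ e') ↔
      AlgebraicIndependent ℚ fun o : Option E ↦ o.elim (sqLength ρ e) fun i ↦ sqLength ρ i := by
    rw [← algebraicIndependent_equiv (Finset.subtypeInsertEquivOption he).symm]
    have : (fun e' : ↥(insert e E) ↦ sqLength ρ e') ∘ (Finset.subtypeInsertEquivOption he).symm =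
        fun o : Option E ↦ o.elim (sqLength ρ e) fun i ↦ sqLength ρ i :=
      funext fun o ↦ by cases o <;> rfl
    rw [this]
  simp only [forall_aeval_spherePoly_iff, aeval_sqLengthPoly, ← key]
  exact ⟨fun ⟨ρ, h⟩ ↦ ⟨fun p ↦ ρ p.1 p.2, h⟩, fun ⟨x, h⟩ ↦ ⟨_, h⟩⟩

theorem setOf_sqLength_eq (e : Finset ℕ) :
    {y | ∃ x : ℕ × Fin d → ℂ, (∀ v : W, aeval x (spherePoly d v) = 0) ∧
      (∀ i : E, aeval x (sqLengthPoly d i) = μ i) ∧ aeval x (sqLengthPoly d e) = y} =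
    {y | ∃ ρ : ℕ → Fin d → ℂ, (NormalizedOn W ρ ∧ ∀ e ∈ E, sqLength ρ e = μ e) ∧
      sqLength ρ e = y} := by
  ext y
  simp only [forall_aeval_spherePoly_iff, aeval_sqLengthPoly, Set.mem_ofPred_eq, and_assoc]
  simp only [Subtype.forall]
  exact ⟨fun ⟨x, h⟩ ↦ ⟨_, h⟩, fun ⟨ρ, h⟩ ↦ ⟨fun p ↦ ρ p.1 p.2, h⟩⟩

theorem GenericallyIndependent.exists_sqLength_eq (h : GenericallyIndependent d W E)
    (hμ : AlgebraicIndependent ℚ fun e : E ↦ μ e) :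
    ∃ ρ : ℕ → Fin d → ℂ, NormalizedOn W ρ ∧ ∀ e ∈ E, sqLength ρ e = μ e := by
  obtain ⟨ρ, hW, hρ⟩ := h
  obtain ⟨x, hx, hf⟩ := exists_aeval_eq_of_algebraicIndependent
    (h := fun v : W ↦ spherePoly d v) (f := fun e : E ↦ sqLengthPoly d e)
    ⟨fun p ↦ ρ p.1 p.2, (forall_aeval_spherePoly_iff W _).2 hW, by
      simpa only [aeval_sqLengthPoly] using hρ⟩ hμ
  exact ⟨_, (forall_aeval_spherePoly_iff W x).1 hx, fun e he ↦
    (aeval_sqLengthPoly x e).symm.trans (hf ⟨e, he⟩)⟩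

theorem MaximallyIndependent.finite_sq_dist {V : Finset ℕ} (h : MaximallyIndependent d W V E)
    (hμ : AlgebraicIndependent ℚ fun e : E ↦ μ e) {u v : ℕ} (hu : u ∈ V) (hv : v ∈ V) :
    {y | ∃ ρ : ℕ → Fin d → ℂ, (NormalizedOn W ρ ∧ ∀ e ∈ E, sqLength ρ e = μ e) ∧
      ∑ i, (ρ u i - ρ v i) ^ 2 = y}.Finite := by
  obtain rfl | huv := eq_or_ne u v
  · refine (Set.finite_singleton 0).subset ?_
    rintro _ ⟨ρ, -, rfl⟩
    simp
  simp_rw [← sqLength_pair _ huv]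
  by_cases he : {u, v} ∈ E
  · refine (Set.finite_singleton (μ {u, v})).subset ?_
    rintro _ ⟨ρ, ⟨-, hρ⟩, rfl⟩
    exact hρ _ he
  · rw [← setOf_sqLength_eq]
    exact finite_aeval_of_not_algebraicIndependent
      (mt (genericallyIndependent_insert_iff he).2 (h.2 u hu v hv huv he)) hμ

theorem maximallyIndependent_of_finite_quot {V : Finset ℕ}
    (hμ : AlgebraicIndependent ℚ fun e : E ↦ μ e) {P : (ℕ → Fin d → ℂ) → Prop}
    (hP : ∀ ρ, P ρ ↔ NormalizedOn W ρ ∧ ∀ e ∈ E, sqLength ρ e = μ e)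
    {r : (ℕ → Fin d → ℂ) → (ℕ → Fin d → ℂ) → Prop}
    (hr : ∀ ρ ρ', r ρ ρ' → ∀ u ∈ V, ∀ v ∈ V,
      ∑ i, (ρ' u i - ρ' v i) ^ 2 = ∑ i, (ρ u i - ρ v i) ^ 2)
    (hfin : Finite (Quot fun ρ ρ' : {ρ // P ρ} ↦ r ρ.1 ρ'.1))
    (hne : Nonempty (Quot fun ρ ρ' : {ρ // P ρ} ↦ r ρ.1 ρ'.1)) :
    MaximallyIndependent d W V E := by
  obtain ⟨q⟩ := hne
  obtain ⟨⟨ρ, hρ⟩, -⟩ := q.exists_rep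
  rw [hP] at hρ
  refine ⟨⟨ρ, hρ.1, ?_⟩, fun u hu v hv huv he h ↦ ?_⟩
  · convert hμ using 2 with e
    exact hρ.2 e e.2
  have hinf := infinite_aeval_of_algebraicIndependent
    ((genericallyIndependent_insert_iff he).1 h) hμ
  rw [setOf_sqLength_eq] at hinf
  let g : (Quot fun ρ ρ' : {ρ // P ρ} ↦ r ρ.1 ρ'.1) → ℂ :=
    Quot.lift (fun ρ ↦ sqLength ρ.1 {u, v}) fun ρ ρ' hρ ↦ by
      rw [sqLength_pair _ huv, sqLength_pair _ huv, hr _ _ hρ u hu v hv]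
  refine hinf ((Set.finite_range g).subset ?_)
  rintro _ ⟨ρ, hρ, rfl⟩
  exact ⟨Quot.mk _ ⟨ρ, (hP ρ).2 hρ⟩, rfl⟩

end Realizations

theorem finite_quot_of_forall_eq {S T : Type*} [Finite T] {r : S → S → Prop} (φ : S → T)
    (h : ∀ s s', φ s = φ s' → r s s') : Finite (Quot r) :=
  .of_surjective (fun y : Set.range φ ↦ Quot.mk r y.2.choose) fun q ↦ by
    obtain ⟨s, rfl⟩ := q.exists_rep
    exact ⟨⟨φ s, s, rfl⟩, Quot.sound (h _ _ (Set.mem_range_self (f := φ) s).choose_spec)⟩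

theorem finite_quot_of_forall_sq_eq {S K L : Type*} [Finite K] [Finite L] {r : S → S → Prop}
    (g : K → S → ℂ) (m : L → S → ℂ) (hg : ∀ k, (Set.range (g k)).Finite)
    (hm : ∀ s s', (∀ k, g k s = g k s') → ∀ l, m l s ^ 2 = m l s' ^ 2)
    (h : ∀ s s', (∀ k, g k s = g k s') → (∀ l, m l s = m l s') → r s s') :
    Finite (Quot r) := by
  have := fun k ↦ (hg k).to_subtype
  let G (s : S) (k : K) : Set.range (g k) := ⟨g k s, s, rfl⟩
  let R (s : S) : S := (Set.mem_range_self (f := G) s).choose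
  have hR (s : S) : G (R s) = G s := (Set.mem_range_self (f := G) s).choose_spec
  have hG {s s' : S} (hs : G s = G s') (k : K) : g k s = g k s' :=
    congrArg Subtype.val (congrFun hs k)
  refine finite_quot_of_forall_eq (fun s ↦ (G s, fun l ↦ m l s = m l (R s))) fun s s' hs ↦ ?_
  obtain ⟨h1, h2⟩ := Prod.ext_iff.1 hs
  have hRs : R s = R s' := by
    have aux (y : (k : K) → Set.range (g k)) (hy : G s = y) (h : y ∈ Set.range G) :
        R s = h.choose := by subst hy; rfl
    exact aux _ h1 _
  refine h s s' (hG h1) fun l ↦ ?_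
  have h3 : (m l s = m l (R s)) = (m l s' = m l (R s')) := congrFun h2 l
  rw [hRs] at h3
  have e1 := sq_eq_sq_iff_eq_or_eq_neg.1 (hm _ _ (hG (h1.trans (hR s').symm)) l)
  have e2 := sq_eq_sq_iff_eq_or_eq_neg.1 (hm _ _ (hG (hR s').symm) l)
  grind

theorem exists_specialOrthogonal_of_transpose_mul_eq {n : Type*} [Fintype n] [DecidableEq n]
    {M M' : Matrix n n ℂ} (h : M.transpose * M = M'.transpose * M') (hdet : M.det = M'.det)
    (h0 : M.det ≠ 0) :
    ∃ A : Matrix n n ℂ, A * A.transpose = 1 ∧ A.det = 1 ∧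
      ∀ x x', M.transpose.mulVec x = M'.transpose.mulVec x' → x' = A.mulVec x := by
  have hM : M * M⁻¹ = 1 := M.mul_nonsing_inv (isUnit_iff_ne_zero.2 h0)
  refine ⟨M' * M⁻¹, ?_, ?_, fun x x' hx ↦ ?_⟩
  · rw [mul_eq_one_comm, Matrix.transpose_mul, Matrix.mul_assoc, ← Matrix.mul_assoc _ M', ← h,
      Matrix.mul_assoc, hM, Matrix.mul_one, ← Matrix.transpose_mul, hM, Matrix.transpose_one]
  · rw [Matrix.det_mul, ← hdet, ← Matrix.det_mul, hM, Matrix.det_one]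
  · refine Matrix.mulVec_injective_of_isUnit (A := M'.transpose) ?_ ?_
    · rw [Matrix.isUnit_iff_isUnit_det, Matrix.det_transpose, ← hdet]
      exact isUnit_iff_ne_zero.2 h0
    · rw [← hx, Matrix.mulVec_mulVec, ← Matrix.mul_assoc, ← h, Matrix.mul_assoc, hM,
        Matrix.mul_one]

theorem sum_sq_mulVec_of_mul_transpose_eq_one {n : Type*} [Fintype n] [DecidableEq n]
    {A : Matrix n n ℂ} (hA : A * A.transpose = 1) (x : n → ℂ) :
    ∑ i, A.mulVec x i ^ 2 = ∑ i, x i ^ 2 := by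
  have h (y : n → ℂ) : ∑ i, y i ^ 2 = dotProduct y y := by simp [dotProduct, sq]
  rw [h, h, Matrix.dotProduct_mulVec, Matrix.vecMul_mulVec, mul_eq_one_comm.1 hA,
    Matrix.vecMul_one]

theorem forall_pair_iff_forall_sqLength {d : ℕ} {E : Finset (Finset ℕ)}
    (hE : ∀ e ∈ E, e.card = 2) (ρ : ℕ → Fin d → ℂ) (μ : Finset ℕ → ℂ) :
    (∀ u v : ℕ, ({u, v} : Finset ℕ) ∈ E → ∑ i, (ρ u i - ρ v i) ^ 2 = μ {u, v}) ↔
      ∀ e ∈ E, sqLength ρ e = μ e := by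
  refine ⟨fun h e he ↦ ?_, fun h u v he ↦ ?_⟩
  · obtain ⟨u, v, huv, rfl⟩ := Finset.card_eq_two.1 (hE e he)
    rw [sqLength_pair _ huv, h u v he]
  · have huv : u ≠ v := by
      rintro rfl
      simpa using hE _ he
    rw [← sqLength_pair _ huv, h _ he]

theorem planeInduces_iff (G : GeoGraph) (lam : Finset ℕ → ℝ) (ρ : ℕ → Fin 2 → ℂ) :
    PlaneInduces G ρ lam ↔ NormalizedOn ∅ ρ ∧ ∀ e ∈ G.E, sqLength ρ e = (lam e : ℂ) :=
  (forall_pair_iff_forall_sqLength G.edge_two ρ fun e ↦ (lam e : ℂ)).trans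
    (by simp [NormalizedOn])

theorem sphereInduces_iff (G : GeoGraph) (lam : Finset ℕ → ℝ) (ρ : ℕ → Fin 3 → ℂ) :
    SphereRealization G ρ ∧ SphereInduces G ρ lam ↔
      NormalizedOn G.V ρ ∧ ∀ e ∈ G.E, sqLength ρ e = (lam e : ℂ) :=
  and_congr_right fun _ ↦ forall_pair_iff_forall_sqLength G.edge_two ρ fun e ↦ (lam e : ℂ)

theorem Generic.algebraicIndependent_complex {G : GeoGraph} {lam : Finset ℕ → ℝ}
    (h : Generic G lam) : AlgebraicIndependent ℚ fun e : G.E ↦ (lam e : ℂ) :=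
  h.2.map' (f := Complex.ofRealAm.restrictScalars ℚ) Complex.ofReal_injective

theorem exists_generic (G : GeoGraph) : ∃ lam, Generic G lam := by
  obtain ⟨x, hx, h⟩ := exists_pos_algebraicIndependent G.E
  refine ⟨fun e ↦ if he : e ∈ G.E then x ⟨e, he⟩ else 0, fun e he ↦ by simp [he, hx], ?_⟩
  convert h using 2 with e
  simp

theorem PlaneCongruent.sum_sq_eq {G : GeoGraph} {ρ ρ' : ℕ → Fin 2 → ℂ}
    (h : PlaneCongruent G ρ ρ') {u v : ℕ} (hu : u ∈ G.V) (hv : v ∈ G.V) :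
    ∑ i, (ρ' u i - ρ' v i) ^ 2 = ∑ i, (ρ u i - ρ v i) ^ 2 := by
  obtain ⟨A, b, hA, -, h⟩ := h
  rw [h u hu, h v hv, ← sum_sq_mulVec_of_mul_transpose_eq_one hA fun i ↦ ρ u i - ρ v i]
  change _ = ∑ i, A.mulVec (ρ u - ρ v) i ^ 2
  simp [Matrix.mulVec_sub]

theorem SphereCongruent.sum_sq_eq {G : GeoGraph} {ρ ρ' : ℕ → Fin 3 → ℂ}
    (h : SphereCongruent G ρ ρ') {u v : ℕ} (hu : u ∈ G.V) (hv : v ∈ G.V) :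
    ∑ i, (ρ' u i - ρ' v i) ^ 2 = ∑ i, (ρ u i - ρ v i) ^ 2 := by
  obtain ⟨A, hA, -, h⟩ := h
  rw [h u hu, h v hv, ← sum_sq_mulVec_of_mul_transpose_eq_one hA fun i ↦ ρ u i - ρ v i]
  change _ = ∑ i, A.mulVec (ρ u - ρ v) i ^ 2
  simp [Matrix.mulVec_sub]

theorem maximallyIndependent_plane_of_finite_classes {G : GeoGraph}
    (h : ∀ lam : Finset ℕ → ℝ, Generic G lam →
      Finite (PlaneClasses G lam) ∧ Nonempty (PlaneClasses G lam)) :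
    MaximallyIndependent 2 ∅ G.V G.E := by
  obtain ⟨lam, hlam⟩ := exists_generic G
  exact maximallyIndependent_of_finite_quot (μ := fun e ↦ (lam e : ℂ))
    hlam.algebraicIndependent_complex (planeInduces_iff G lam)
    (fun _ _ h _ hu _ hv ↦ h.sum_sq_eq hu hv) (h lam hlam).1 (h lam hlam).2

theorem maximallyIndependent_sphere_of_finite_classes {G : GeoGraph}
    (h : ∀ lam : Finset ℕ → ℝ, Generic G lam →
      Finite (SphereClasses G lam) ∧ Nonempty (SphereClasses G lam)) :
    MaximallyIndependent 3 G.V G.V G.E := by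
  obtain ⟨lam, hlam⟩ := exists_generic G
  exact maximallyIndependent_of_finite_quot (μ := fun e ↦ (lam e : ℂ))
    hlam.algebraicIndependent_complex (sphereInduces_iff G lam)
    (fun _ _ h _ hu _ hv ↦ h.sum_sq_eq hu hv) (h lam hlam).1 (h lam hlam).2

theorem planeCongruent_of_subsingleton {G : GeoGraph} (hV : (G.V : Set ℕ).Subsingleton)
    (ρ ρ' : ℕ → Fin 2 → ℂ) : PlaneCongruent G ρ ρ' := by
  obtain h | ⟨u, hu⟩ := G.V.eq_empty_or_nonempty
  · exact ⟨1, 0, by simp, by simp, by simp [h]⟩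
  · refine ⟨1, ρ' u - ρ u, by simp, by simp, fun v hv ↦ ?_⟩
    rw [hV hv hu]
    simp

theorem planeCongruent_of_forall_eq {G : GeoGraph} {ρ ρ' : ℕ → Fin 2 → ℂ} {u v : ℕ}
    (hu : u ∈ G.V) (hv : v ∈ G.V) (huv : ∑ i, (ρ u i - ρ v i) ^ 2 ≠ 0)
    (hd : ∀ a ∈ G.V, ∀ b ∈ G.V, ∑ i, (ρ a i - ρ b i) ^ 2 = ∑ i, (ρ' a i - ρ' b i) ^ 2)
    (hm : ∀ w ∈ G.V, (ρ v 0 - ρ u 0) * (ρ w 1 - ρ u 1) - (ρ v 1 - ρ u 1) * (ρ w 0 - ρ u 0) =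
      (ρ' v 0 - ρ' u 0) * (ρ' w 1 - ρ' u 1) - (ρ' v 1 - ρ' u 1) * (ρ' w 0 - ρ' u 0)) :
    PlaneCongruent G ρ ρ' := by
  simp only [Fin.sum_univ_two] at hd huv
  let M (σ : ℕ → Fin 2 → ℂ) : Matrix (Fin 2) (Fin 2) ℂ :=
    !![σ v 0 - σ u 0, -(σ v 1 - σ u 1); σ v 1 - σ u 1, σ v 0 - σ u 0]
  have hMM (σ : ℕ → Fin 2 → ℂ) : (M σ).transpose * M σ =
      ((σ u 0 - σ v 0) ^ 2 + (σ u 1 - σ v 1) ^ 2) • 1 := by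
    ext i j
    fin_cases i <;> fin_cases j <;> simp [M, Matrix.mul_apply, Fin.sum_univ_two] <;> ring
  have hdet (σ : ℕ → Fin 2 → ℂ) : (M σ).det = (σ u 0 - σ v 0) ^ 2 + (σ u 1 - σ v 1) ^ 2 := by
    simp only [M, Matrix.det_fin_two_of]
    ring
  obtain ⟨A, hA, hA1, h⟩ := exists_specialOrthogonal_of_transpose_mul_eq (M := M ρ) (M' := M ρ')
    (by rw [hMM, hMM, hd u hu v hv]) (by rw [hdet, hdet, hd u hu v hv]) (by rwa [hdet])
  refine ⟨A, ρ' u - A.mulVec (ρ u), hA, hA1, fun w hw ↦ ?_⟩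
  have := h (ρ w - ρ u) (ρ' w - ρ' u) (by
    ext i
    fin_cases i
    · simp [M, Matrix.mulVec, dotProduct, Fin.sum_univ_two]
      linear_combination (hd u hu w hw + hd u hu v hv - hd v hv w hw) / 2
    · simp [M, Matrix.mulVec, dotProduct, Fin.sum_univ_two]
      linear_combination hm w hw)
  rw [Matrix.mulVec_sub] at this
  rw [← sub_add_cancel (ρ' w) (ρ' u), this]
  abel

theorem finite_planeClasses {G : GeoGraph} (h : MaximallyIndependent 2 ∅ G.V G.E)
    {lam : Finset ℕ → ℝ} (hlam : Generic G lam) : Finite (PlaneClasses G lam) := by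
  obtain ⟨u, hu, v, hv, huv, he⟩ | hV := h.exists_pair_mem_or_subsingleton G.edge_sub G.edge_two
  · refine finite_quot_of_forall_sq_eq (K := G.V × G.V) (L := G.V)
      (fun k ρ ↦ ∑ i, (ρ.1 k.1 i - ρ.1 k.2 i) ^ 2)
      (fun w ρ ↦ (ρ.1 v 0 - ρ.1 u 0) * (ρ.1 w 1 - ρ.1 u 1) -
        (ρ.1 v 1 - ρ.1 u 1) * (ρ.1 w 0 - ρ.1 u 0)) (fun k ↦ ?_) (fun ρ ρ' hd w ↦ ?_)
      fun ρ ρ' hd hm ↦ planeCongruent_of_forall_eq hu hv ?_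
        (fun a ha b hb ↦ hd (⟨a, ha⟩, ⟨b, hb⟩)) fun w hw ↦ hm ⟨w, hw⟩
    · refine (h.finite_sq_dist (μ := fun e ↦ (lam e : ℂ)) hlam.algebraicIndependent_complex
        k.1.2 k.2.2).subset ?_
      rintro _ ⟨ρ, rfl⟩
      exact ⟨ρ.1, (planeInduces_iff G lam _).1 ρ.2, rfl⟩
    · have key (σ : ℕ → Fin 2 → ℂ) : ((σ v 0 - σ u 0) * (σ w 1 - σ u 1) -
          (σ v 1 - σ u 1) * (σ w 0 - σ u 0)) ^ 2 =
          (∑ i, (σ u i - σ v i) ^ 2) * (∑ i, (σ u i - σ w i) ^ 2) -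
          ((∑ i, (σ u i - σ v i) ^ 2 + ∑ i, (σ u i - σ w i) ^ 2 -
            ∑ i, (σ v i - σ w i) ^ 2) / 2) ^ 2 := by
        simp only [Fin.sum_univ_two]
        ring
      rw [key, key, hd (⟨u, hu⟩, ⟨v, hv⟩), hd (⟨u, hu⟩, w), hd (⟨v, hv⟩, w)]
    · rw [ρ.2 u v he]
      exact hlam.algebraicIndependent_complex.ne_zero ⟨_, he⟩
  · exact finite_quot_of_forall_eq (fun _ ↦ ()) fun _ _ _ ↦ planeCongruent_of_subsingleton hV _ _

/-- The matrix with columns `p`, `q` and `p × q`. -/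
def crossFrame (p q : Fin 3 → ℂ) : Matrix (Fin 3) (Fin 3) ℂ :=
  !![p 0, q 0, p 1 * q 2 - p 2 * q 1;
     p 1, q 1, p 2 * q 0 - p 0 * q 2;
     p 2, q 2, p 0 * q 1 - p 1 * q 0]

theorem crossFrame_transpose_mul {p q : Fin 3 → ℂ} (hp : ∑ i, p i ^ 2 = 1)
    (hq : ∑ i, q i ^ 2 = 1) :
    (crossFrame p q).transpose * crossFrame p q =
      !![1, dotProduct p q, 0; dotProduct p q, 1, 0; 0, 0, 1 - dotProduct p q ^ 2] := by
  simp only [Fin.sum_univ_three, dotProduct] at hp hq ⊢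
  ext i j
  fin_cases i <;> fin_cases j <;> simp [crossFrame, Matrix.mul_apply, Fin.sum_univ_three]
  · linear_combination hp
  · ring
  · ring
  · linear_combination hq
  · ring
  · ring
  · ring
  · linear_combination (q 0 ^ 2 + q 1 ^ 2 + q 2 ^ 2) * hp + hq

theorem det_crossFrame {p q : Fin 3 → ℂ} (hp : ∑ i, p i ^ 2 = 1) (hq : ∑ i, q i ^ 2 = 1) :
    (crossFrame p q).det = 1 - dotProduct p q ^ 2 := by
  simp only [Fin.sum_univ_three, dotProduct] at hp hq ⊢
  simp only [crossFrame, Matrix.det_fin_three, Matrix.of_apply, Matrix.cons_val]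
  linear_combination (q 0 ^ 2 + q 1 ^ 2 + q 2 ^ 2) * hp + hq

theorem exists_specialOrthogonal_of_dotProduct_eq {p q p' q' : Fin 3 → ℂ}
    (hp : ∑ i, p i ^ 2 = 1) (hq : ∑ i, q i ^ 2 = 1) (hp' : ∑ i, p' i ^ 2 = 1)
    (hq' : ∑ i, q' i ^ 2 = 1) (h : dotProduct p q = dotProduct p' q')
    (h0 : 1 - dotProduct p q ^ 2 ≠ 0) :
    ∃ A : Matrix (Fin 3) (Fin 3) ℂ, A * A.transpose = 1 ∧ A.det = 1 ∧
      ∀ x x', dotProduct p x = dotProduct p' x' → dotProduct q x = dotProduct q' x' →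
        (crossFrame p q).transpose.mulVec x 2 = (crossFrame p' q').transpose.mulVec x' 2 →
        x' = A.mulVec x := by
  obtain ⟨A, hA, hA1, hAx⟩ := exists_specialOrthogonal_of_transpose_mul_eq
    (M := crossFrame p q) (M' := crossFrame p' q')
    (by rw [crossFrame_transpose_mul hp hq, crossFrame_transpose_mul hp' hq', h])
    (by rw [det_crossFrame hp hq, det_crossFrame hp' hq', h]) (by rwa [det_crossFrame hp hq])
  refine ⟨A, hA, hA1, fun x x' h1 h2 h3 ↦ hAx x x' (funext fun i ↦ ?_)⟩
  fin_cases i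
  · simpa [crossFrame, Matrix.mulVec, dotProduct, Fin.sum_univ_three] using h1
  · simpa [crossFrame, Matrix.mulVec, dotProduct, Fin.sum_univ_three] using h2
  · exact h3

theorem exists_unit_dotProduct_eq_zero {p : Fin 3 → ℂ} (hp : ∑ i, p i ^ 2 = 1) :
    ∃ q : Fin 3 → ℂ, ∑ i, q i ^ 2 = 1 ∧ dotProduct p q = 0 := by
  have key (x : Fin 3 → ℂ) (hx : ∑ i, x i ^ 2 ≠ 0) (hpx : dotProduct p x = 0) :
      ∃ q : Fin 3 → ℂ, ∑ i, q i ^ 2 = 1 ∧ dotProduct p q = 0 := by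
    obtain ⟨r, hr⟩ := IsAlgClosed.exists_pow_nat_eq (∑ i, x i ^ 2) two_pos
    refine ⟨r⁻¹ • x, ?_, by rw [dotProduct_smul, hpx, smul_zero]⟩
    simp_rw [Pi.smul_apply, smul_eq_mul, mul_pow, ← Finset.mul_sum, ← hr]
    rw [← hr] at hx
    rw [← mul_pow, inv_mul_cancel₀ (ne_zero_pow two_ne_zero hx), one_pow]
  by_contra! h
  have h' (x : Fin 3 → ℂ) (hpx : dotProduct p x = 0) : ∑ i, x i ^ 2 = 0 := by
    by_contra hx
    obtain ⟨q, hq, hpq⟩ := key x hx hpx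
    exact h q hq hpq
  have h0 := h' ![0, p 2, -p 1] (by simp [dotProduct, Fin.sum_univ_three]; ring)
  have h1 := h' ![p 2, 0, -p 0] (by simp [dotProduct, Fin.sum_univ_three]; ring)
  have h2 := h' ![p 1, -p 0, 0] (by simp [dotProduct, Fin.sum_univ_three]; ring)
  simp only [Fin.sum_univ_three, Matrix.cons_val] at h0 h1 h2 hp
  exact two_ne_zero (α := ℂ) (by linear_combination h0 + h1 + h2 - 2 * hp)

theorem sphereCongruent_of_subsingleton {G : GeoGraph} (hV : (G.V : Set ℕ).Subsingleton)
    {ρ ρ' : ℕ → Fin 3 → ℂ} (hρ : SphereRealization G ρ) (hρ' : SphereRealization G ρ') :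
    SphereCongruent G ρ ρ' := by
  obtain h | ⟨u, hu⟩ := G.V.eq_empty_or_nonempty
  · exact ⟨1, by simp, by simp, by simp [h]⟩
  obtain ⟨q, hq, hpq⟩ := exists_unit_dotProduct_eq_zero (hρ u hu)
  obtain ⟨q', hq', hpq'⟩ := exists_unit_dotProduct_eq_zero (hρ' u hu)
  obtain ⟨A, hA, hA1, h⟩ := exists_specialOrthogonal_of_dotProduct_eq (hρ u hu) hq (hρ' u hu) hq'
    (hpq.trans hpq'.symm) (by simp [hpq])
  refine ⟨A, hA, hA1, fun v hv ↦ ?_⟩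
  rw [hV hv hu]
  refine h _ _ ?_ ?_ ?_
  · have h1 := hρ u hu
    have h2 := hρ' u hu
    simp only [sq] at h1 h2
    exact h1.trans h2.symm
  · rw [dotProduct_comm, hpq, dotProduct_comm, hpq']
  · simp [crossFrame, Matrix.mulVec, dotProduct, Fin.sum_univ_three]
    ring

theorem dotProduct_eq_one_sub_of_unit {n : Type*} [Fintype n] {p q : n → ℂ}
    (hp : ∑ i, p i ^ 2 = 1) (hq : ∑ i, q i ^ 2 = 1) :
    dotProduct p q = 1 - (∑ i, (p i - q i) ^ 2) / 2 := by
  have : ∑ i, (p i - q i) ^ 2 = ∑ i, p i ^ 2 + ∑ i, q i ^ 2 - 2 * dotProduct p q := by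
    rw [dotProduct, Finset.mul_sum, ← Finset.sum_add_distrib, ← Finset.sum_sub_distrib]
    exact Finset.sum_congr rfl fun i _ ↦ by ring
  rw [this, hp, hq]
  ring

theorem crossFrame_transpose_mulVec_sq {p q x : Fin 3 → ℂ} (hp : ∑ i, p i ^ 2 = 1)
    (hq : ∑ i, q i ^ 2 = 1) (hx : ∑ i, x i ^ 2 = 1) :
    (crossFrame p q).transpose.mulVec x 2 ^ 2 =
      1 + 2 * dotProduct p q * dotProduct p x * dotProduct q x - dotProduct p q ^ 2 -
        dotProduct p x ^ 2 - dotProduct q x ^ 2 := by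
  have gram : (crossFrame p q).transpose.mulVec x 2 ^ 2 =
      (∑ i, p i ^ 2) * (∑ i, q i ^ 2) * (∑ i, x i ^ 2) +
        2 * dotProduct p q * dotProduct p x * dotProduct q x -
        dotProduct p q ^ 2 * (∑ i, x i ^ 2) - dotProduct p x ^ 2 * (∑ i, q i ^ 2) -
        dotProduct q x ^ 2 * (∑ i, p i ^ 2) := by
    simp [crossFrame, Matrix.mulVec, dotProduct, Fin.sum_univ_three]
    ring
  rw [gram, hp, hq, hx]
  ring

theorem finite_sphereClasses {G : GeoGraph} (h : MaximallyIndependent 3 G.V G.V G.E)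
    {lam : Finset ℕ → ℝ} (hlam : Generic G lam) : Finite (SphereClasses G lam) := by
  have hplane := (maximallyIndependent_plane_iff_sphere G.edge_sub G.edge_two).2 h
  obtain ⟨u, hu, v, hv, huv, he⟩ | hV :=
    hplane.exists_pair_mem_or_subsingleton G.edge_sub G.edge_two
  · have dot {ρ ρ' : {ρ // SphereRealization G ρ ∧ SphereInduces G ρ lam}}
        (hd : ∀ k : G.V × G.V, ∑ i, (ρ.1 k.1 i - ρ.1 k.2 i) ^ 2 =
          ∑ i, (ρ'.1 k.1 i - ρ'.1 k.2 i) ^ 2) {a b : ℕ} (ha : a ∈ G.V) (hb : b ∈ G.V) :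
        dotProduct (ρ.1 a) (ρ.1 b) = dotProduct (ρ'.1 a) (ρ'.1 b) := by
      rw [dotProduct_eq_one_sub_of_unit (ρ.2.1 a ha) (ρ.2.1 b hb),
        dotProduct_eq_one_sub_of_unit (ρ'.2.1 a ha) (ρ'.2.1 b hb), hd (⟨a, ha⟩, ⟨b, hb⟩)]
    refine finite_quot_of_forall_sq_eq (K := G.V × G.V) (L := G.V)
      (fun k ρ ↦ ∑ i, (ρ.1 k.1 i - ρ.1 k.2 i) ^ 2)
      (fun w ρ ↦ (crossFrame (ρ.1 u) (ρ.1 v)).transpose.mulVec (ρ.1 w) 2)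
      (fun k ↦ ?_) (fun ρ ρ' hd w ↦ ?_) fun ρ ρ' hd hm ↦ ?_
    · refine (h.finite_sq_dist (μ := fun e ↦ (lam e : ℂ)) hlam.algebraicIndependent_complex
        k.1.2 k.2.2).subset ?_
      rintro _ ⟨ρ, rfl⟩
      exact ⟨ρ.1, (sphereInduces_iff G lam _).1 ρ.2, rfl⟩
    · rw [crossFrame_transpose_mulVec_sq (ρ.2.1 u hu) (ρ.2.1 v hv) (ρ.2.1 w w.2),
        crossFrame_transpose_mulVec_sq (ρ'.2.1 u hu) (ρ'.2.1 v hv) (ρ'.2.1 w w.2),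
        dot hd hu hv, dot hd hu w.2, dot hd hv w.2]
    · obtain ⟨A, hA, hA1, hAx⟩ := exists_specialOrthogonal_of_dotProduct_eq (ρ.2.1 u hu)
        (ρ.2.1 v hv) (ρ'.2.1 u hu) (ρ'.2.1 v hv) (dot hd hu hv) (by
          rw [dotProduct_eq_one_sub_of_unit (ρ.2.1 u hu) (ρ.2.1 v hv), ρ.2.2 u v he]
          have ht := hlam.algebraicIndependent_complex.transcendental ⟨_, he⟩
          intro h0
          have : (lam {u, v} : ℂ) * (lam {u, v} - 4) = 0 := by linear_combination -4 * h0
          obtain h1 | h1 := mul_eq_zero.1 this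
          · exact ht (by simpa [h1] using isAlgebraic_zero)
          · refine ht ?_
            simp only [sub_eq_zero.1 h1]
            exact_mod_cast isAlgebraic_natCast (R := ℚ) (A := ℂ) 4)
      exact ⟨A, hA, hA1, fun w hw ↦ hAx _ _ (dot hd hu hw) (dot hd hv hw) (hm ⟨w, hw⟩)⟩
  · exact finite_quot_of_forall_eq (fun _ ↦ ()) fun ρ ρ' _ ↦
      sphereCongruent_of_subsingleton hV ρ.2.1 ρ'.2.1

theorem finite_planeClasses_iff_maximallyIndependent (G : GeoGraph) :
    (∀ lam : Finset ℕ → ℝ, Generic G lam →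
      Finite (PlaneClasses G lam) ∧ Nonempty (PlaneClasses G lam)) ↔
    MaximallyIndependent 2 ∅ G.V G.E := by
  refine ⟨maximallyIndependent_plane_of_finite_classes, fun h lam hlam ↦
    ⟨finite_planeClasses h hlam, ?_⟩⟩
  obtain ⟨ρ, hρ⟩ := h.1.exists_sqLength_eq (μ := fun e ↦ (lam e : ℂ))
    hlam.algebraicIndependent_complex
  exact ⟨Quot.mk _ ⟨ρ, (planeInduces_iff G lam ρ).2 hρ⟩⟩

theorem finite_sphereClasses_iff_maximallyIndependent (G : GeoGraph) :
    (∀ lam : Finset ℕ → ℝ, Generic G lam →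
      Finite (SphereClasses G lam) ∧ Nonempty (SphereClasses G lam)) ↔
    MaximallyIndependent 3 G.V G.V G.E := by
  refine ⟨maximallyIndependent_sphere_of_finite_classes, fun h lam hlam ↦
    ⟨finite_sphereClasses h hlam, ?_⟩⟩
  obtain ⟨ρ, hρ⟩ := h.1.exists_sqLength_eq (μ := fun e ↦ (lam e : ℂ))
    hlam.algebraicIndependent_complex
  exact ⟨Quot.mk _ ⟨ρ, (sphereInduces_iff G lam ρ).2 hρ⟩⟩

/-- A graph is minimally rigid in the plane iff it is minimally rigid on the sphere. -/
theorem plane_rigid_iff_sphere_rigid (G : GeoGraph) :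
    (∀ lam : Finset ℕ → ℝ, Generic G lam →
      Finite (PlaneClasses G lam) ∧ Nonempty (PlaneClasses G lam)) ↔
    (∀ lam : Finset ℕ → ℝ, Generic G lam →
      Finite (SphereClasses G lam) ∧ Nonempty (SphereClasses G lam)) := by
  rw [finite_planeClasses_iff_maximallyIndependent, finite_sphereClasses_iff_maximallyIndependent]
  exact maximallyIndependent_plane_iff_sphere G.edge_sub G.edge_two
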